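/- Let n ≥ 2 and let x ∈ B n be pure (π x = 1), palindromic (rev x = x), and satisfy Δ n⁻¹ * x * Δ n = x. Then there exists a unique δ ∈ B n such that x = δ * rev δ and Δ n⁻¹ * δ * Δ n = δ. -/

import Mathlib

/-- The braid relators on `n` strands: `σᵢσⱼσᵢ = σⱼσᵢσⱼ` when `|i−j| = 1` and
`σᵢσⱼ = σⱼσᵢ` when `|i−j| ≥ 2`. -/
def braidRels (n : ℕ) : Set (FreeGroup (Fin (n - 1))) :=
  { r | ∃ i j : Fin (n - 1),
      ((i : ℕ) + 1 = (j : ℕ) ∧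
        r = (FreeGroup.of i * FreeGroup.of j * FreeGroup.of i) *
            (FreeGroup.of j * FreeGroup.of i * FreeGroup.of j)⁻¹) ∨
      ((i : ℕ) + 2 ≤ (j : ℕ) ∧
        r = (FreeGroup.of i * FreeGroup.of j) * (FreeGroup.of j * FreeGroup.of i)⁻¹) }

/-- The braid group on `n` strands, as a presented group on `n - 1` generators. -/
def BraidGroup (n : ℕ) : Type := PresentedGroup (braidRels n)

instance (n : ℕ) : Group (BraidGroup n) := QuotientGroup.Quotient.group _

/-- The Artin generator `σ i` of the braid group (here `i : Fin (n-1)` corresponds to the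
classical generator `σ_{i+1}`). -/
def braidGen {n : ℕ} (i : Fin (n - 1)) : BraidGroup n := PresentedGroup.of i

/-- `braidGen' n k` is `σ_{k+1}` for `k < n - 1` and `1` otherwise. -/
def braidGen' (n : ℕ) (k : ℕ) : BraidGroup n :=
  if h : k < n - 1 then braidGen ⟨k, h⟩ else 1

/-- `braidAsc n m = σ₁ σ₂ ⋯ σ_m`. -/
def braidAsc (n m : ℕ) : BraidGroup n := ((List.range m).map (braidGen' n)).prod

/-- The Garside element `Δ n = (σ₁ ⋯ σ_{n-1}) (σ₁ ⋯ σ_{n-2}) ⋯ (σ₁ σ₂) (σ₁)`,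
the closed form of the recursion `Δ 2 = σ₁`, `Δ n = σ₁ σ₂ ⋯ σ_{n-1} * Δ (n-1)`. -/
def garside (n : ℕ) : BraidGroup n :=
  ((List.range (n - 1)).map (fun j => braidAsc n (n - 1 - j))).prod

namespace BraidMonoid

/-- Neighbouring generators, which satisfy the braid relation. -/
def Adj {m : ℕ} (i j : Fin m) : Prop := (i : ℕ) + 1 = j ∨ (j : ℕ) + 1 = i

/-- Distant generators, which commute. -/
def Far {m : ℕ} (i j : Fin m) : Prop := (i : ℕ) + 2 ≤ j ∨ (j : ℕ) + 2 ≤ i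

theorem Adj.symm {m : ℕ} {i j : Fin m} (h : Adj i j) : Adj j i := Or.symm h

theorem Far.symm {m : ℕ} {i j : Fin m} (h : Far i j) : Far j i := Or.symm h

/-- Equivalence of positive braid words. -/
inductive WordEq {m : ℕ} : List (Fin m) → List (Fin m) → Prop
  | refl (u) : WordEq u u
  | cons (i) {u v} : WordEq u v → WordEq (i :: u) (i :: v)
  | braid {i j} (w) : Adj i j → WordEq (i :: j :: i :: w) (j :: i :: j :: w)
  | comm {i j} (w) : Far i j → WordEq (i :: j :: w) (j :: i :: w)
  | trans {u v w} : WordEq u v → WordEq v w → WordEq u w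

namespace WordEq

variable {m : ℕ} {u v u' v' : List (Fin m)}

theorem symm (h : WordEq u v) : WordEq v u := by
  induction h with
  | refl u => exact refl u
  | cons i _ ih => exact ih.cons i
  | braid w h => exact braid w h.symm
  | comm w h => exact comm w h.symm
  | trans _ _ ih₁ ih₂ => exact ih₂.trans ih₁

theorem append_right (h : WordEq u v) (w : List (Fin m)) : WordEq (u ++ w) (v ++ w) := by
  induction h with
  | refl u => exact refl _
  | cons i _ ih => exact ih.cons i
  | braid w' h => exact braid _ h
  | comm w' h => exact comm _ h
  | trans _ _ ih₁ ih₂ => exact ih₁.trans ih₂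

theorem append_left (w : List (Fin m)) (h : WordEq u v) : WordEq (w ++ u) (w ++ v) := by
  induction w with
  | nil => exact h
  | cons i _ ih => exact ih.cons i

theorem append (h : WordEq u v) (h' : WordEq u' v') : WordEq (u ++ u') (v ++ v') :=
  (h.append_right u').trans (h'.append_left v)

theorem length_eq (h : WordEq u v) : u.length = v.length := by
  induction h with
  | refl u => rfl
  | cons i _ ih => simp [ih]
  | braid w h => rfl
  | comm w h => rfl
  | trans _ _ ih₁ ih₂ => exact ih₁.trans ih₂

theorem reverse (h : WordEq u v) : WordEq u.reverse v.reverse := by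
  induction h with
  | refl u => exact refl _
  | cons i _ ih => simpa using ih.append_right [i]
  | braid w h => simpa using (braid [] h).append_left w.reverse
  | comm w h => simpa using (comm [] h.symm).append_left w.reverse
  | trans _ _ ih₁ ih₂ => exact ih₁.trans ih₂

end WordEq

/-- Positive braid words up to equivalence. -/
def wordSetoid (m : ℕ) : Setoid (List (Fin m)) :=
  ⟨WordEq, WordEq.refl, WordEq.symm, WordEq.trans⟩

end BraidMonoid

/-- The monoid of positive braids with `m` generators. -/
def BraidMonoid (m : ℕ) : Type := Quotient (BraidMonoid.wordSetoid m)

namespace BraidMonoid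

variable {m : ℕ}

/-- The positive braid represented by a word. -/
def mk (u : List (Fin m)) : BraidMonoid m := Quotient.mk (wordSetoid m) u

theorem mk_eq_mk {u v : List (Fin m)} : mk u = mk v ↔ WordEq u v :=
  Quotient.eq (r := wordSetoid m)

theorem mk_surjective : Function.Surjective (mk : List (Fin m) → BraidMonoid m) :=
  Quotient.mk_surjective

instance : Monoid (BraidMonoid m) where
  mul := Quotient.map₂ (· ++ ·) fun _ _ h _ _ h' => WordEq.append h h'
  one := mk []
  mul_assoc := by
    rintro ⟨a⟩ ⟨b⟩ ⟨c⟩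
    exact congrArg mk (List.append_assoc a b c)
  one_mul := by
    rintro ⟨a⟩
    rfl
  mul_one := by
    rintro ⟨a⟩
    exact congrArg mk (List.append_nil a)

/-- The generators of the braid monoid. -/
def gen (i : Fin m) : BraidMonoid m := mk [i]

@[elab_as_elim]
theorem induction_on {p : BraidMonoid m → Prop} (a : BraidMonoid m) (one : p 1)
    (gen_mul : ∀ i a, p a → p (gen i * a)) : p a := by
  obtain ⟨u, rfl⟩ := mk_surjective a
  induction u with
  | nil => exact one
  | cons i u ih => exact gen_mul i _ ih

theorem eq_one_or_gen_mul (a : BraidMonoid m) : a = 1 ∨ ∃ i b, a = gen i * b :=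
  induction_on a (.inl rfl) fun i b _ => .inr ⟨i, b, rfl⟩

theorem gen_braid {i j : Fin m} (h : Adj i j) :
    gen i * gen j * gen i = gen j * gen i * gen j :=
  mk_eq_mk.2 (WordEq.braid [] h)

theorem gen_comm {i j : Fin m} (h : Far i j) : gen i * gen j = gen j * gen i :=
  mk_eq_mk.2 (WordEq.comm [] h)

theorem gen_braid_mul {i j : Fin m} (h : Adj i j) (a : BraidMonoid m) :
    gen i * (gen j * (gen i * a)) = gen j * (gen i * (gen j * a)) := by
  simp only [← mul_assoc, gen_braid h]

theorem gen_comm_mul {i j : Fin m} (h : Far i j) (a : BraidMonoid m) :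
    gen i * (gen j * a) = gen j * (gen i * a) := by
  simp only [← mul_assoc, gen_comm h]

/-- The homomorphism out of the braid monoid determined by a family satisfying its relations. -/
def lift {N : Type*} [Monoid N] (f : Fin m → N)
    (hb : ∀ i j, Adj i j → f i * f j * f i = f j * f i * f j)
    (hc : ∀ i j, Far i j → f i * f j = f j * f i) : BraidMonoid m →* N where
  toFun := Quotient.lift (fun u => (u.map f).prod) fun u v (h : WordEq u v) => by
    induction h with
    | refl u => rfl
    | cons i _ ih => simp_all
    | braid w h => simp [← mul_assoc, hb _ _ h]
    | comm w h => simp [← mul_assoc, hc _ _ h]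
    | trans _ _ ih₁ ih₂ => exact ih₁.trans ih₂
  map_one' := rfl
  map_mul' := by
    rintro ⟨u⟩ ⟨v⟩
    exact (congrArg List.prod List.map_append).trans List.prod_append

theorem lift_gen {N : Type*} [Monoid N] (f : Fin m → N) (hb hc) (i : Fin m) :
    lift f hb hc (gen i) = f i := List.prod_singleton

/-- The number of letters of a positive braid. -/
def len : BraidMonoid m → ℕ := Quotient.lift List.length fun _ _ h => WordEq.length_eq h

@[simp]
theorem len_mul (a b : BraidMonoid m) : len (a * b) = len a + len b := by
  obtain ⟨u, rfl⟩ := mk_surjective a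
  obtain ⟨v, rfl⟩ := mk_surjective b
  exact List.length_append

@[simp]
theorem len_one : len (1 : BraidMonoid m) = 0 := rfl

@[simp]
theorem len_gen (i : Fin m) : len (gen i) = 1 := rfl

theorem len_eq_zero {a : BraidMonoid m} : len a = 0 ↔ a = 1 := by
  refine ⟨fun h => ?_, fun h => by simp [h]⟩
  obtain rfl | ⟨i, b, rfl⟩ := eq_one_or_gen_mul a
  · rfl
  · simp at h

/-- Word reversal on positive braids. -/
def rev : BraidMonoid m → BraidMonoid m := Quotient.map List.reverse fun _ _ h => WordEq.reverse h

@[simp]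
theorem rev_mul (a b : BraidMonoid m) : rev (a * b) = rev b * rev a := by
  obtain ⟨u, rfl⟩ := mk_surjective a
  obtain ⟨v, rfl⟩ := mk_surjective b
  exact congrArg mk List.reverse_append

@[simp]
theorem rev_one : rev (1 : BraidMonoid m) = 1 := rfl

@[simp]
theorem rev_gen (i : Fin m) : rev (gen i) = gen i := rfl

@[simp]
theorem rev_rev (a : BraidMonoid m) : rev (rev a) = a := by
  obtain ⟨u, rfl⟩ := mk_surjective a
  exact congrArg mk (List.reverse_reverse u)

@[simp]
theorem len_rev (a : BraidMonoid m) : len (rev a) = len a := by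
  obtain ⟨u, rfl⟩ := mk_surjective a
  exact List.length_reverse

/-- The expected shape of the tails of two words starting with `i` and `j` and representing the
same positive braid. -/
def Confluent (i j : Fin m) (a b : BraidMonoid m) : Prop :=
  (i = j ∧ a = b) ∨
  (Adj i j ∧ ∃ c, a = gen j * (gen i * c) ∧ b = gen i * (gen j * c)) ∨
  (Far i j ∧ ∃ c, a = gen j * c ∧ b = gen i * c)

theorem eq_or_adj_or_far (i j : Fin m) : i = j ∨ Adj i j ∨ Far i j := by
  rw [Fin.ext_iff]
  unfold Adj Far
  omega

theorem Adj.ne {i j : Fin m} (h : Adj i j) : i ≠ j := by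
  rw [Ne, Fin.ext_iff]; unfold Adj at h; omega

theorem Far.ne {i j : Fin m} (h : Far i j) : i ≠ j := by
  rw [Ne, Fin.ext_iff]; unfold Far at h; omega

theorem Far.not_adj {i j : Fin m} (h : Far i j) : ¬ Adj i j := by
  unfold Far at h; unfold Adj; omega

theorem Confluent.eq {i : Fin m} {a b : BraidMonoid m} (h : Confluent i i a b) : a = b := by
  obtain h | h | h := h
  · exact h.2
  · exact absurd rfl h.1.ne
  · exact absurd rfl h.1.ne

theorem Confluent.of_adj {i j : Fin m} {a b : BraidMonoid m} (h : Confluent i j a b)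
    (hij : Adj i j) : ∃ c, a = gen j * (gen i * c) ∧ b = gen i * (gen j * c) := by
  obtain h | h | h := h
  · exact absurd h.1 hij.ne
  · exact h.2
  · exact absurd hij h.1.not_adj

theorem Confluent.of_far {i j : Fin m} {a b : BraidMonoid m} (h : Confluent i j a b)
    (hij : Far i j) : ∃ c, a = gen j * c ∧ b = gen i * c := by
  obtain h | h | h := h
  · exact absurd h.1 hij.ne
  · exact absurd h.1 hij.not_adj
  · exact h.2

theorem not_adj_triangle {i j k : Fin m} (h₁ : Adj i k) (h₂ : Adj k j) : ¬ Adj i j := by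
  unfold Adj at *; omega

section Transitivity

variable {l : ℕ} {i j k : Fin m} {v w : BraidMonoid m}

theorem confluent_of_adj_adj
    (H : ∀ (i j : Fin m) (a b : BraidMonoid m), len a < l → gen i * a = gen j * b →
      Confluent i j a b)
    (hl : len w + 2 = l) (hik : Adj i k) (hkj : Adj k j)
    (h : gen i * (gen k * w) = gen j * (gen k * v)) :
    Confluent i j (gen k * (gen i * w)) (gen k * (gen j * v)) := by
  obtain rfl | hij | hij := eq_or_adj_or_far i j
  · have h := (H _ _ _ _ (by simp; omega) h).eq
    exact .inl ⟨rfl, by rw [(H _ _ _ _ (by omega) h).eq]⟩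
  · exact absurd hij (not_adj_triangle hik hkj)
  · have hlen := congrArg len h
    obtain ⟨z, hz, hz'⟩ := (H _ _ _ _ (by simp; omega) h).of_far hij
    simp only [len_mul, len_gen] at hlen
    obtain ⟨y, rfl, rfl⟩ := (H _ _ _ _ (by omega) hz).of_adj hkj
    obtain ⟨y', rfl, hy⟩ := (H _ _ _ _ (by omega) hz').of_adj hik.symm
    simp only [len_mul, len_gen] at hl
    have hy := (H _ _ _ _ (by simp; omega) hy).eq
    obtain ⟨x, rfl, rfl⟩ := (H _ _ _ _ (by omega) hy).of_far hij.symm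
    refine .inr (.inr ⟨hij, gen k * (gen i * (gen j * (gen k * x))), ?_, ?_⟩)
    · rw [gen_comm_mul hij (gen k * (gen i * x)), gen_braid_mul hik x,
        gen_braid_mul hkj (gen i * (gen k * x)), gen_comm_mul hij.symm (gen k * x)]
    · rw [gen_comm_mul hij.symm (gen k * (gen j * x)), gen_braid_mul hkj.symm x,
        gen_braid_mul hik.symm (gen j * (gen k * x))]

theorem confluent_of_adj_far
    (H : ∀ (i j : Fin m) (a b : BraidMonoid m), len a < l → gen i * a = gen j * b →
      Confluent i j a b)
    (hl : len w + 2 = l) (hik : Adj i k) (hkj : Far k j)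
    (h : gen i * (gen k * w) = gen j * v) :
    Confluent i j (gen k * (gen i * w)) (gen k * v) := by
  obtain rfl | hij | hij := eq_or_adj_or_far i j
  · exact absurd hik.symm hkj.not_adj
  · obtain ⟨x, hx, rfl⟩ := (H _ _ _ _ (by simp; omega) h).of_adj hij
    obtain ⟨y, rfl, hy⟩ := (H _ _ _ _ (by omega) hx).of_far hkj
    have hlen := congrArg len hy
    simp only [len_mul, len_gen] at hl hlen
    obtain ⟨z, rfl, rfl⟩ := (H _ _ _ _ (by omega) hy).of_adj hik
    refine .inr (.inl ⟨hij, gen k * (gen i * (gen j * z)), ?_, ?_⟩)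
    · rw [gen_braid_mul hij (gen k * z), gen_comm_mul hkj (gen i * (gen j * (gen k * z))),
        gen_comm_mul hkj.symm z, gen_braid_mul hik.symm (gen j * z)]
    · rw [gen_comm_mul hkj.symm (gen i * z), gen_braid_mul hik.symm (gen j * (gen i * z)),
        gen_braid_mul hij z, gen_comm_mul hkj (gen i * (gen j * z))]
  · obtain ⟨x, hx, rfl⟩ := (H _ _ _ _ (by simp; omega) h).of_far hij
    obtain ⟨y, rfl, rfl⟩ := (H _ _ _ _ (by omega) hx).of_far hkj
    refine .inr (.inr ⟨hij, gen k * (gen i * y), ?_, gen_braid_mul hik.symm y⟩)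
    rw [gen_comm_mul hij y, gen_comm_mul hkj (gen i * y)]

theorem Confluent.symm {a b : BraidMonoid m} (h : Confluent i j a b) : Confluent j i b a := by
  obtain ⟨rfl, rfl⟩ | ⟨h, c, rfl, rfl⟩ | ⟨h, c, rfl, rfl⟩ := h
  · exact .inl ⟨rfl, rfl⟩
  · exact .inr (.inl ⟨h.symm, c, rfl, rfl⟩)
  · exact .inr (.inr ⟨h.symm, c, rfl, rfl⟩)

theorem confluent_of_far_far
    (H : ∀ (i j : Fin m) (a b : BraidMonoid m), len a < l → gen i * a = gen j * b →
      Confluent i j a b)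
    (hl : len w + 1 = l) (hik : Far i k) (hkj : Far k j) (h : gen i * w = gen j * v) :
    Confluent i j (gen k * w) (gen k * v) := by
  obtain ⟨rfl, rfl⟩ | ⟨hij, x, rfl, rfl⟩ | ⟨hij, x, rfl, rfl⟩ := H _ _ _ _ (by omega) h
  · exact .inl ⟨rfl, rfl⟩
  · refine .inr (.inl ⟨hij, gen k * x, ?_, ?_⟩)
    · rw [gen_comm_mul hkj, gen_comm_mul hik.symm]
    · rw [gen_comm_mul hik.symm, gen_comm_mul hkj]
  · exact .inr (.inr ⟨hij, gen k * x, gen_comm_mul hkj x, gen_comm_mul hik.symm x⟩)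

theorem Confluent.trans
    (H : ∀ (i j : Fin m) (a b : BraidMonoid m), len a < l → gen i * a = gen j * b →
      Confluent i j a b)
    {a b c : BraidMonoid m} (hl : len b = l)
    (h₁ : Confluent i k a b) (h₂ : Confluent k j b c) : Confluent i j a c := by
  obtain ⟨rfl, rfl⟩ | ⟨hik, w, rfl, rfl⟩ | ⟨hik, w, rfl, rfl⟩ := h₁
  · exact h₂
  · obtain ⟨rfl, rfl⟩ | ⟨hkj, v, h, rfl⟩ | ⟨hkj, v, h, rfl⟩ := h₂
    · exact .inr (.inl ⟨hik, w, rfl, rfl⟩)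
    · exact confluent_of_adj_adj H (by simp at hl; omega) hik hkj h
    · exact confluent_of_adj_far H (by simp at hl; omega) hik hkj h
  · obtain ⟨rfl, rfl⟩ | ⟨hkj, v, h, rfl⟩ | ⟨hkj, v, h, rfl⟩ := h₂
    · exact .inr (.inr ⟨hik, w, rfl, rfl⟩)
    · have hlen := congrArg len h
      simp only [len_mul, len_gen] at hl hlen
      exact (confluent_of_adj_far H (by omega) hkj.symm hik.symm h.symm).symm
    · exact confluent_of_far_far H (by simp at hl; omega) hik hkj h

end Transitivity

theorem WordEq.confluent {l : ℕ}
    (H : ∀ (i j : Fin m) (a b : BraidMonoid m), len a < l → gen i * a = gen j * b →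
      Confluent i j a b)
    {u v : List (Fin m)} (h : WordEq u v) :
    ∀ {i j u' v'}, u = i :: u' → v = j :: v' → u'.length = l →
      Confluent i j (mk u') (mk v') := by
  induction h with
  | refl u =>
    rintro i j u' v' rfl h -
    obtain ⟨rfl, rfl⟩ := List.cons.inj h
    exact .inl ⟨rfl, rfl⟩
  | cons k h _ =>
    rintro i j u' v' h₁ h₂ -
    obtain ⟨rfl, rfl⟩ := List.cons.inj h₁
    obtain ⟨rfl, rfl⟩ := List.cons.inj h₂
    exact .inl ⟨rfl, mk_eq_mk.2 h⟩
  | braid w h =>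
    rintro i j u' v' h₁ h₂ -
    obtain ⟨rfl, rfl⟩ := List.cons.inj h₁
    obtain ⟨rfl, rfl⟩ := List.cons.inj h₂
    exact .inr (.inl ⟨h, mk w, rfl, rfl⟩)
  | comm w h =>
    rintro i j u' v' h₁ h₂ -
    obtain ⟨rfl, rfl⟩ := List.cons.inj h₁
    obtain ⟨rfl, rfl⟩ := List.cons.inj h₂
    exact .inr (.inr ⟨h, mk w, rfl, rfl⟩)
  | @trans u w v huw hwv ih₁ ih₂ =>
    rintro i j u' v' rfl rfl hl
    have hlen := huw.length_eq
    cases w with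
    | nil => simp at hlen
    | cons k w =>
      have hw : w.length = l := by simp at hlen; omega
      exact Confluent.trans H (b := mk w) hw (ih₁ rfl rfl hl) (ih₂ rfl rfl hw)

/-- Garside's theorem on positive braids divisible by two generators. -/
theorem confluent_of_gen_mul_eq {i j : Fin m} {a b : BraidMonoid m}
    (h : gen i * a = gen j * b) : Confluent i j a b := by
  induction hl : len a using Nat.strong_induction_on generalizing i j a b with
  | _ l ih =>
    obtain ⟨u, rfl⟩ := mk_surjective a
    obtain ⟨v, rfl⟩ := mk_surjective b
    exact (mk_eq_mk.1 h).confluent (fun i j a b hab h => ih _ hab h rfl) rfl rfl hl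

instance : IsLeftCancelMul (BraidMonoid m) where
  mul_left_cancel a b c h := by
    induction a using induction_on with
    | one => simpa using h
    | gen_mul i a ih =>
      simp only [mul_assoc] at h
      exact ih (confluent_of_gen_mul_eq h).eq

theorem dvd_of_mul_dvd_mul_left {a b c : BraidMonoid m} (h : a * b ∣ a * c) : b ∣ c := by
  obtain ⟨d, hd⟩ := h
  exact ⟨d, mul_left_cancel (hd.trans (mul_assoc ..))⟩

theorem rev_injective : Function.Injective (rev : BraidMonoid m → BraidMonoid m) :=
  Function.LeftInverse.injective rev_rev

instance : IsRightCancelMul (BraidMonoid m) where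
  mul_right_cancel a b c h := by
    apply rev_injective
    have := congrArg rev h
    simpa using this

theorem exists_lcm_gen (i j : Fin m) : ∃ x y : BraidMonoid m, gen i * x = gen j * y ∧
    ∀ a b, gen i * a = gen j * b → ∃ c, a = x * c ∧ b = y * c := by
  obtain rfl | h | h := eq_or_adj_or_far i j
  · exact ⟨1, 1, rfl, fun a b hab => ⟨a, by simp, by simpa using hab.symm⟩⟩
  · refine ⟨gen j * gen i, gen i * gen j, by simpa [mul_assoc] using gen_braid h,
      fun a b hab => ?_⟩
    obtain ⟨c, rfl, rfl⟩ := (confluent_of_gen_mul_eq hab).of_adj h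
    exact ⟨c, (mul_assoc ..).symm, (mul_assoc ..).symm⟩
  · refine ⟨gen j, gen i, gen_comm h, fun a b hab => ?_⟩
    exact (confluent_of_gen_mul_eq hab).of_far h

/-- Positive braids with a common right multiple have a least one. -/
theorem exists_lcm {a b m₀ : BraidMonoid m} (ha : a ∣ m₀) (hb : b ∣ m₀) :
    ∃ l, a ∣ l ∧ b ∣ l ∧ ∀ c, a ∣ c → b ∣ c → l ∣ c := by
  induction hl : len m₀ using Nat.strong_induction_on generalizing a b m₀ with
  | _ n ih =>
    obtain rfl | ⟨i, a, rfl⟩ := eq_one_or_gen_mul a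
    · exact ⟨b, one_dvd _, dvd_rfl, fun _ _ h => h⟩
    obtain rfl | ⟨j, b, rfl⟩ := eq_one_or_gen_mul b
    · exact ⟨gen i * a, dvd_rfl, one_dvd _, fun _ h _ => h⟩
    obtain ⟨a₀, rfl⟩ := ha
    obtain ⟨b₀, hb⟩ := hb
    obtain ⟨x, y, hxy, hmin⟩ := exists_lcm_gen i j
    simp only [mul_assoc] at hb
    simp only [len_mul, len_gen] at hl
    have hlen := congrArg len hb
    simp only [len_mul, len_gen] at hlen
    obtain ⟨c₀, hc, hc'⟩ := hmin _ _ hb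
    have hlc := congrArg len hc
    simp only [len_mul] at hlc
    obtain ⟨_, ha₁, ⟨e, rfl⟩, hL⟩ := ih (len (a * a₀)) (by simp; omega) (Dvd.intro _ rfl)
      (Dvd.intro _ hc.symm) rfl
    obtain ⟨_, hb₁, ⟨f, rfl⟩, hL'⟩ := ih (len (b * b₀)) (by simp; omega) (Dvd.intro _ rfl)
      (Dvd.intro _ hc'.symm) rfl
    obtain ⟨g, heg, hfg, hg⟩ := ih (len c₀) (by omega)
      (dvd_of_mul_dvd_mul_left (hL _ ⟨a₀, hc.symm⟩ (Dvd.intro _ rfl)))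
      (dvd_of_mul_dvd_mul_left (hL' _ ⟨b₀, hc'.symm⟩ (Dvd.intro _ rfl))) rfl
    refine ⟨gen i * (x * g), ?_, ?_, ?_⟩
    · exact mul_dvd_mul_left _ (ha₁.trans (mul_dvd_mul_left _ heg))
    · rw [← mul_assoc, hxy, mul_assoc]
      exact mul_dvd_mul_left _ (hb₁.trans (mul_dvd_mul_left _ hfg))
    · rintro _ ⟨a₁, rfl⟩ ⟨b₁, h⟩
      simp only [mul_assoc] at h ⊢
      obtain ⟨c, h, h'⟩ := hmin _ _ h
      rw [h]
      refine mul_dvd_mul_left _ (mul_dvd_mul_left _ (hg _ ?_ ?_))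
      · exact dvd_of_mul_dvd_mul_left (hL _ ⟨a₁, h.symm⟩ (Dvd.intro _ rfl))
      · exact dvd_of_mul_dvd_mul_left (hL' _ ⟨b₁, h'.symm⟩ (Dvd.intro _ rfl))

/-- `gen' k` is the generator with index `k` for `k < m` and `1` otherwise. -/
def gen' (m k : ℕ) : BraidMonoid m := if h : k < m then gen ⟨k, h⟩ else 1

/-- The ascending product of the first `k` generators. -/
def asc (m k : ℕ) : BraidMonoid m := ((List.range k).map (gen' m)).prod

/-- The Garside element on the first `k` generators. -/
def delta (m : ℕ) : ℕ → BraidMonoid m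
  | 0 => 1
  | k + 1 => asc m (k + 1) * delta m k

theorem gen'_of_lt {k : ℕ} (h : k < m) : gen' m k = gen ⟨k, h⟩ := dif_pos h

@[simp]
theorem rev_gen' (k : ℕ) : rev (gen' m k) = gen' m k := by
  unfold gen'; split <;> rfl

theorem asc_succ (k : ℕ) : asc m (k + 1) = asc m k * gen' m k := by
  simp [asc, List.range_succ]

theorem gen'_comm {i j : ℕ} (h : i + 2 ≤ j) (hj : j < m) :
    gen' m i * gen' m j = gen' m j * gen' m i := by
  rw [gen'_of_lt hj, gen'_of_lt (by omega)]
  exact gen_comm (.inl h)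

theorem gen'_braid {i : ℕ} (h : i + 1 < m) :
    gen' m i * gen' m (i + 1) * gen' m i = gen' m (i + 1) * gen' m i * gen' m (i + 1) := by
  rw [gen'_of_lt h, gen'_of_lt (by omega)]
  exact gen_braid (.inl rfl)

theorem asc_mul_gen'_of_lt {j k : ℕ} (h : k < j) (hj : j < m) :
    asc m k * gen' m j = gen' m j * asc m k := by
  induction k with
  | zero => simp [asc]
  | succ k ih =>
    rw [asc_succ, mul_assoc, gen'_comm (by omega) hj, ← mul_assoc, ih (by omega), mul_assoc]

theorem asc_mul_gen' {i k : ℕ} (hi : i + 1 < k) (hk : k ≤ m) :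
    asc m k * gen' m i = gen' m (i + 1) * asc m k := by
  induction k with
  | zero => omega
  | succ k ih =>
    obtain rfl | h := Nat.lt_succ_iff_lt_or_eq.1 hi |>.symm
    · rw [asc_succ, asc_succ, mul_assoc, mul_assoc, ← mul_assoc (gen' m i), gen'_braid (by omega),
        ← mul_assoc, ← mul_assoc, asc_mul_gen'_of_lt (by omega) (by omega)]
      simp only [mul_assoc]
    · rw [asc_succ, mul_assoc, ← gen'_comm (by omega) (by omega), ← mul_assoc, ih h (by omega),
        mul_assoc]

theorem delta_mul_gen'_of_lt {j k : ℕ} (h : k < j) (hj : j < m) :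
    delta m k * gen' m j = gen' m j * delta m k := by
  induction k with
  | zero => simp [delta]
  | succ k ih =>
    rw [delta, mul_assoc, ih (by omega), ← mul_assoc, asc_mul_gen'_of_lt h hj, mul_assoc]

theorem delta_succ_eq_mul_rev_asc {k : ℕ} (hk : k + 1 ≤ m) :
    delta m (k + 1) = delta m k * rev (asc m (k + 1)) := by
  induction k with
  | zero => simp [delta, asc]
  | succ k ih =>
    have h : delta m (k + 2) = asc m (k + 2) * (delta m k * rev (asc m (k + 1))) :=
      congrArg _ (ih (by omega))
    rw [h, asc_succ (k + 1), rev_mul, rev_gen', mul_assoc, ← mul_assoc (gen' m _),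
      ← delta_mul_gen'_of_lt (by omega) (by omega), delta]
    simp only [mul_assoc]

theorem rev_delta {k : ℕ} (hk : k ≤ m) : rev (delta m k) = delta m k := by
  induction k with
  | zero => rfl
  | succ k ih =>
    rw [delta_succ_eq_mul_rev_asc hk, rev_mul, ih (by omega), rev_rev,
      ← delta_succ_eq_mul_rev_asc hk]
    rfl

theorem delta_mul_gen' {i k : ℕ} (hi : i < k) (hk : k ≤ m) :
    delta m k * gen' m i = gen' m (k - 1 - i) * delta m k := by
  induction k generalizing i with
  | zero => omega
  | succ k ih =>
    obtain h | rfl := Nat.lt_succ_iff_lt_or_eq.1 hi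
    · rw [delta, mul_assoc, ih h (by omega), ← mul_assoc, asc_mul_gen' (by omega) hk, mul_assoc]
      congr 2
      omega
    · cases i with
      | zero => simp [delta, asc]
      | succ i =>
        have h := congrArg rev (asc_mul_gen' (m := m) (i := i) (k := i + 2) (by omega) hk)
        simp only [rev_mul, rev_gen'] at h
        rw [delta_succ_eq_mul_rev_asc hk, mul_assoc, ← h, ← mul_assoc, ih (by omega) (by omega),
          mul_assoc]
        simp

/-- The Garside element of the braid monoid. -/
def garsideElt (m : ℕ) : BraidMonoid m := delta m m

theorem rev_garsideElt : rev (garsideElt m) = garsideElt m := rev_delta le_rfl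

theorem garsideElt_mul_gen (i : Fin m) :
    garsideElt m * gen i = gen i.rev * garsideElt m := by
  have hi : i.rev = ⟨m - 1 - i, by omega⟩ := Fin.ext (by simp only [Fin.val_rev]; omega)
  have h := delta_mul_gen' i.isLt le_rfl
  rwa [gen'_of_lt i.isLt, gen'_of_lt (by omega), ← hi] at h

theorem exists_garsideElt_mul (a : BraidMonoid m) :
    ∃ b, garsideElt m * a = b * garsideElt m := by
  induction a using induction_on with
  | one => exact ⟨1, by simp⟩
  | gen_mul i a ih =>
    obtain ⟨b, hb⟩ := ih
    exact ⟨gen i.rev * b, by rw [← mul_assoc, garsideElt_mul_gen, mul_assoc, hb, mul_assoc]⟩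

theorem exists_mul_garsideElt (a : BraidMonoid m) :
    ∃ b, a * garsideElt m = garsideElt m * b := by
  obtain ⟨b, hb⟩ := exists_garsideElt_mul (rev a)
  refine ⟨rev b, ?_⟩
  simpa [rev_garsideElt] using congrArg rev hb

theorem garsideElt_sq_comm (a : BraidMonoid m) :
    garsideElt m * garsideElt m * a = a * (garsideElt m * garsideElt m) := by
  induction a using induction_on with
  | one => simp
  | gen_mul i a ih =>
    rw [← mul_assoc, mul_assoc (garsideElt m), garsideElt_mul_gen, ← mul_assoc, garsideElt_mul_gen,
      Fin.rev_rev, mul_assoc (gen i), mul_assoc (gen i), ih, mul_assoc]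

theorem last_gen_dvd_delta {k : ℕ} (hk : k + 1 ≤ m) : gen' m k ∣ delta m (k + 1) := by
  induction k with
  | zero => simp [delta, asc]
  | succ k ih =>
    obtain ⟨z, hz⟩ := ih (by omega)
    rw [delta, hz, ← mul_assoc, asc_mul_gen' (by omega) hk, mul_assoc]
    exact dvd_mul_right _ _

theorem gen_dvd_delta {i k : ℕ} (hi : i < k) (hk : k ≤ m) : gen' m i ∣ delta m k := by
  induction k with
  | zero => omega
  | succ k ih =>
    obtain h | rfl := Nat.lt_succ_iff_lt_or_eq.1 hi
    · rw [delta_succ_eq_mul_rev_asc hk]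
      exact (ih h (by omega)).mul_right _
    · exact last_gen_dvd_delta hk

theorem gen_dvd_garsideElt (i : Fin m) : gen i ∣ garsideElt m := by
  rw [← gen'_of_lt i.isLt]
  exact gen_dvd_delta i.isLt le_rfl

theorem exists_mul_eq_garsideElt_sq_pow (a : BraidMonoid m) :
    ∃ (b : BraidMonoid m) (k : ℕ), a * b = (garsideElt m * garsideElt m) ^ k := by
  induction a using induction_on with
  | one => exact ⟨1, 0, by simp⟩
  | gen_mul i a ih =>
    obtain ⟨b, k, h⟩ := ih
    obtain ⟨c, hc⟩ := (gen_dvd_garsideElt i).mul_right (garsideElt m)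
    refine ⟨b * c, k + 1, ?_⟩
    rw [mul_assoc, ← mul_assoc a, h, ← mul_assoc,
      ← (Commute.pow_left (garsideElt_sq_comm (gen i)) k).eq, mul_assoc, ← hc, pow_succ]

/-- Right divisors of the Garside element are left divisors of it. -/
theorem dvd_garsideElt_of_mul_eq {a b : BraidMonoid m} (h : a * b = garsideElt m) :
    b ∣ garsideElt m := by
  obtain ⟨c, hc⟩ := exists_mul_garsideElt a
  refine ⟨c, mul_left_cancel (a := a) ?_⟩
  rw [hc, ← mul_assoc, h]

theorem rev_dvd_garsideElt {a : BraidMonoid m} (h : a ∣ garsideElt m) :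
    rev a ∣ garsideElt m := by
  obtain ⟨b, hb⟩ := h
  refine dvd_garsideElt_of_mul_eq (a := rev b) ?_
  rw [← rev_mul, ← hb, rev_garsideElt]

theorem dvd_mul_garsideElt (a : BraidMonoid m) {u : BraidMonoid m} (h : u ∣ garsideElt m) :
    u ∣ a * garsideElt m := by
  obtain ⟨b, hb⟩ := exists_mul_garsideElt a
  exact hb ▸ h.mul_right b

section Permutations

/-- The inversions of a permutation. -/
def inversions {n : ℕ} (σ : Equiv.Perm (Fin n)) : Finset (Fin n × Fin n) :=
  {p | p.1 < p.2 ∧ σ p.2 < σ p.1}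

theorem mem_inversions {n : ℕ} {σ : Equiv.Perm (Fin n)} {p : Fin n × Fin n} :
    p ∈ inversions σ ↔ p.1 < p.2 ∧ σ p.2 < σ p.1 := by
  simp [inversions]

theorem card_inversions_swap_mul_le (i : Fin m) (σ : Equiv.Perm (Fin (m + 1))) :
    (inversions (Equiv.swap i.castSucc i.succ * σ)).card ≤ (inversions σ).card + 1 := by
  refine (Finset.card_le_card (t := insert (σ⁻¹ i.castSucc, σ⁻¹ i.succ) (inversions σ)) ?_).trans
    (Finset.card_insert_le _ _)
  rintro ⟨p, q⟩ h
  simp only [mem_inversions, Equiv.Perm.mul_apply,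
    Finset.mem_insert, Prod.mk.injEq, Equiv.Perm.eq_inv_iff_eq] at h ⊢
  obtain ⟨hpq, h⟩ := h
  have hne : σ p ≠ σ q := fun h => hpq.ne (σ.injective h)
  simp only [Equiv.swap_apply_def, Fin.ext_iff, Fin.lt_def, Fin.val_castSucc, Fin.val_succ,
    ne_eq] at h hne hpq ⊢
  split_ifs at h <;> simp_all <;> omega

variable (φ : BraidMonoid m →* Equiv.Perm (Fin (m + 1)))

theorem card_inversions_le_len (hφ : ∀ i, φ (gen i) = Equiv.swap i.castSucc i.succ)
    (a : BraidMonoid m) : (inversions (φ a)).card ≤ len a := by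
  induction a using induction_on with
  | one =>
    rw [map_one, len_one, Nat.le_zero, Finset.card_eq_zero, inversions,
      Finset.filter_eq_empty_iff]
    exact fun p _ h => lt_asymm h.1 h.2
  | gen_mul i a ih =>
    rw [map_mul, hφ, len_mul, len_gen]
    exact (card_inversions_swap_mul_le i _).trans (by omega)

theorem val_map_asc (hφ : ∀ i, φ (gen i) = Equiv.swap i.castSucc i.succ) {k : ℕ} (hk : k ≤ m)
    (p : Fin (m + 1)) :
    (φ (asc m k) p : ℕ) = if (p : ℕ) < k then (p : ℕ) + 1 else if (p : ℕ) = k then 0 else p := by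
  induction k generalizing p with
  | zero =>
    simp [asc]
  | succ k ih =>
    rw [asc_succ, map_mul, Equiv.Perm.mul_apply, ih (by omega), gen'_of_lt (by omega), hφ,
      Equiv.swap_apply_def]
    simp only [Fin.ext_iff, Fin.val_castSucc, Fin.val_succ]
    split_ifs <;> simp_all <;> omega

theorem val_map_delta (hφ : ∀ i, φ (gen i) = Equiv.swap i.castSucc i.succ) {k : ℕ} (hk : k ≤ m)
    (p : Fin (m + 1)) :
    (φ (delta m k) p : ℕ) = if (p : ℕ) ≤ k then k - (p : ℕ) else p := by
  induction k with
  | zero =>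
    simp only [delta, map_one, Equiv.Perm.one_apply]
    split_ifs <;> omega
  | succ k ih =>
    rw [delta, map_mul, Equiv.Perm.mul_apply, val_map_asc φ hφ hk, ih (by omega)]
    split_ifs <;> omega

theorem len_gen' {k : ℕ} (h : k < m) : len (gen' m k) = 1 := by
  rw [gen'_of_lt h, len_gen]

theorem len_asc {k : ℕ} (hk : k ≤ m) : len (asc m k) = k := by
  induction k with
  | zero => rfl
  | succ k ih => rw [asc_succ, len_mul, ih (by omega), len_gen' (by omega)]

theorem len_delta {k : ℕ} (hk : k ≤ m) : len (delta m k) = ∑ i ∈ Finset.range (k + 1), i := by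
  induction k with
  | zero => rfl
  | succ k ih =>
    rw [delta, len_mul, len_asc hk, ih (by omega), Finset.sum_range_succ _ (k + 1), add_comm]

theorem len_garsideElt_le (hφ : ∀ i, φ (gen i) = Equiv.swap i.castSucc i.succ) :
    len (garsideElt m) ≤ (inversions (φ (garsideElt m))).card := by
  have h : inversions (φ (garsideElt m)) = Finset.univ.filter fun p => p.1 < p.2 := by
    refine Finset.filter_congr fun p _ => and_iff_left_of_imp fun hp => ?_
    rw [Fin.lt_def, garsideElt, val_map_delta φ hφ le_rfl, val_map_delta φ hφ le_rfl]
    have h₂ := p.2.isLt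
    rw [Fin.lt_def] at hp
    split_ifs <;> omega
  rw [h, garsideElt, len_delta le_rfl, Finset.card_filter, Fintype.sum_prod_type,
    ← Finset.sum_range_reflect, ← Fin.sum_univ_eq_sum_range (fun j => m + 1 - 1 - j)]
  refine (Finset.sum_congr rfl fun p _ => ?_).le
  rw [← Finset.card_filter]
  simp [Finset.filter_lt_eq_Ioi]

/-- A simple braid is determined by its permutation; in particular, a pure one is trivial. -/
theorem eq_one_of_dvd_garsideElt (hφ : ∀ i, φ (gen i) = Equiv.swap i.castSucc i.succ)
    {a : BraidMonoid m} (ha : a ∣ garsideElt m) (h : φ a = 1) : a = 1 := by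
  obtain ⟨b, hb⟩ := ha
  have h₁ := len_garsideElt_le φ hφ
  have h₂ := card_inversions_le_len φ hφ b
  rw [hb, map_mul, h, one_mul, len_mul] at h₁
  exact len_eq_zero.1 (by omega)

theorem map_rev (hφ : ∀ i, φ (gen i) = Equiv.swap i.castSucc i.succ) (a : BraidMonoid m) :
    φ (rev a) = (φ a)⁻¹ := by
  induction a using induction_on with
  | one => simp
  | gen_mul i a ih => simp [ih, hφ]

/-- Every pure positive palindrome is of the form `d * rev d`. -/
theorem exists_eq_mul_rev (hφ : ∀ i, φ (gen i) = Equiv.swap i.castSucc i.succ)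
    {q : BraidMonoid m} (hq : rev q = q) (h : φ q = 1) : ∃ d, q = d * rev d := by
  induction hl : len q using Nat.strong_induction_on generalizing q with
  | _ n ih =>
    have hfin : {k | ∃ v, v ∣ q ∧ v ∣ garsideElt m ∧ len v = k}.Finite := by
      refine (Set.finite_Iic (len q)).subset ?_
      rintro _ ⟨v, ⟨w, rfl⟩, -, rfl⟩
      simp
    obtain ⟨_, ⟨v, hvq, hv, rfl⟩, hmax⟩ := hfin.exists_maximal ⟨0, 1, one_dvd _, one_dvd _, rfl⟩
    obtain ⟨z, hz⟩ := hvq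
    have hz' : q = rev z * rev v := by rw [← rev_mul, ← hz, hq]
    obtain hz1 | ⟨i, y, hy⟩ := eq_one_or_gen_mul (rev z)
    · rw [hz1, one_mul] at hz'
      exact ⟨1, by simpa using eq_one_of_dvd_garsideElt φ hφ (hz' ▸ rev_dvd_garsideElt hv) h⟩
    · have hi : gen i ∣ q := ⟨y * rev v, by rw [hz', hy, mul_assoc]⟩
      obtain ⟨_, ⟨c, rfl⟩, hil, hlcm⟩ := exists_lcm (Dvd.intro _ hz.symm : v ∣ q) hi
      have hc := hmax ⟨v * c, hlcm _ (Dvd.intro _ hz.symm) hi, hlcm _ hv (gen_dvd_garsideElt i),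
        rfl⟩ (by simp)
      simp only [len_mul] at hc
      obtain rfl : c = 1 := len_eq_zero.1 (by omega)
      obtain ⟨w, rfl⟩ : gen i ∣ v := by simpa using hil
      have hq' : q = gen i * (y * rev w) * gen i := by
        rw [hz', hy, rev_mul, rev_gen]
        simp only [mul_assoc]
      have hpal : rev (y * rev w) = y * rev w := by
        rw [hq', rev_mul, rev_mul, rev_gen, ← mul_assoc] at hq
        exact mul_left_cancel (mul_right_cancel hq)
      have hone : φ (y * rev w) = 1 := by
        have hi : φ (gen i) * φ (gen i) = 1 := by rw [hφ, Equiv.swap_mul_self]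
        rwa [hq', map_mul, map_mul, ← conj_eq_one_iff (a := φ (gen i)), ← mul_assoc, ← mul_assoc,
          hi, one_mul, mul_inv_cancel_right] at h
      obtain ⟨d, hd⟩ := ih (len (y * rev w)) (by rw [hq'] at hl; simp at hl ⊢; omega) hpal hone rfl
      exact ⟨gen i * d, by rw [hq', hd, rev_mul, rev_gen]; simp only [mul_assoc]⟩

/-- A generator dividing `a * rev a` divides `a`. -/
theorem gen_dvd_of_dvd_mul_rev (hφ : ∀ i, φ (gen i) = Equiv.swap i.castSucc i.succ)
    {i : Fin m} {a : BraidMonoid m} (h : gen i ∣ a * rev a) : gen i ∣ a := by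
  obtain ⟨_, ⟨x, rfl⟩, hix, hlcm⟩ := exists_lcm (dvd_mul_right a (rev a)) h
  obtain ⟨z, hz⟩ := dvd_of_mul_dvd_mul_left (hlcm _ (dvd_mul_right a (rev a)) h)
  obtain rfl : a = rev z * rev x := by rw [← rev_mul, ← hz, rev_rev]
  have hi := gen_dvd_garsideElt i
  have hx : x ∣ garsideElt m :=
    dvd_of_mul_dvd_mul_left (hlcm _ (dvd_mul_right _ _) (dvd_mul_garsideElt _ hi))
  obtain ⟨_, ⟨y, rfl⟩, hiy, hlcm'⟩ :=
    exists_lcm (dvd_mul_right (rev z) (garsideElt m)) (dvd_mul_garsideElt (rev z) hi)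
  have hy : y ∣ garsideElt m :=
    dvd_of_mul_dvd_mul_left (hlcm' _ (dvd_mul_right _ _) (dvd_mul_garsideElt _ hi))
  have hyx : y ∣ rev x * x := by
    refine dvd_of_mul_dvd_mul_left (a := rev z) (hlcm' _ (dvd_mul_right _ _) ?_)
    rwa [← mul_assoc]
  obtain ⟨l, hxl, hyl, hl⟩ := exists_lcm (dvd_mul_right (rev x) x) hyx
  have hdvd : rev x * x ∣ l := by
    refine dvd_of_mul_dvd_mul_left (a := rev z) ?_
    rw [← mul_assoc]
    exact hlcm _ (mul_dvd_mul_left _ hxl) (hiy.trans (mul_dvd_mul_left _ hyl))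
  have hone := eq_one_of_dvd_garsideElt φ hφ (hdvd.trans (hl _ (rev_dvd_garsideElt hx) hy))
    (by rw [map_mul, map_rev φ hφ, inv_mul_cancel])
  have hlen := congrArg len hone
  simp only [len_mul, len_rev, len_one] at hlen
  obtain rfl : x = 1 := len_eq_zero.1 (by omega)
  simpa using hix

theorem mul_rev_injective (hφ : ∀ i, φ (gen i) = Equiv.swap i.castSucc i.succ)
    {a b : BraidMonoid m} (h : a * rev a = b * rev b) : a = b := by
  induction a using induction_on generalizing b with
  | one =>
    have hlen := congrArg len h
    simp only [len_mul, len_rev, len_one] at hlen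
    exact (len_eq_zero.1 (by omega)).symm
  | gen_mul i a ih =>
    obtain ⟨b, rfl⟩ : gen i ∣ b :=
      gen_dvd_of_dvd_mul_rev φ hφ (h ▸ (dvd_mul_right _ _).mul_right _)
    simp only [rev_mul, rev_gen, ← mul_assoc] at h
    have h := mul_right_cancel h
    simp only [mul_assoc] at h
    rw [ih (mul_left_cancel h)]

end Permutations

/-- A cancellative monoid with a central element embeds in a monoid where it is invertible. -/
theorem exists_injective_isUnit {M : Type} [Monoid M] [IsRightCancelMul M] (c : M)
    (hc : ∀ a, c * a = a * c) :
    ∃ (N : Type) (_ : Monoid N) (f : M →* N), Function.Injective f ∧ IsUnit (f c) := by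
  have hS : ∀ (s : Submonoid.powers c) (a : M), (s : M) * a = a * s := by
    rintro ⟨_, k, rfl⟩ a
    exact (Commute.pow_left (hc a) k).eq
  let _ : OreLocalization.OreSet (Submonoid.powers c) :=
    { ore_right_cancel := fun r₁ r₂ s h => ⟨s, by rw [hS, hS, h]⟩
      oreNum := fun r _ => r
      oreDenom := fun _ s => s
      ore_eq := fun r s => hS s r }
  refine ⟨OreLocalization (Submonoid.powers c) M, inferInstance, OreLocalization.numeratorHom,
    fun a b h => ?_, OreLocalization.numerator_isUnit ⟨c, Submonoid.mem_powers c⟩⟩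
  obtain ⟨u, v, h, h'⟩ := OreLocalization.oreDiv_eq_iff.1 h
  simp only [OneMemClass.coe_one, mul_one] at h'
  rw [Submonoid.smul_def, h', smul_eq_mul, smul_eq_mul, ← h', hS, hS] at h
  exact (mul_right_cancel h).symm

end BraidMonoid

section BraidGroup

open BraidMonoid

variable {n : ℕ}

theorem braidGen_braid {i j : Fin (n - 1)} (h : Adj i j) :
    (braidGen i * braidGen j * braidGen i : BraidGroup n) =
      braidGen j * braidGen i * braidGen j := by
  wlog hij : (i : ℕ) + 1 = j generalizing i j
  · exact (this h.symm (h.resolve_left hij)).symm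
  · exact PresentedGroup.mk_eq_mk_of_mul_inv_mem ⟨i, j, .inl ⟨hij, rfl⟩⟩

theorem braidGen_comm {i j : Fin (n - 1)} (h : Far i j) :
    (braidGen i * braidGen j : BraidGroup n) = braidGen j * braidGen i := by
  wlog hij : (i : ℕ) + 2 ≤ j generalizing i j
  · exact (this h.symm (h.resolve_left hij)).symm
  · exact PresentedGroup.mk_eq_mk_of_mul_inv_mem ⟨i, j, .inr ⟨hij, rfl⟩⟩

/-- The canonical map from positive braids to the braid group. -/
def toBraidGroup (n : ℕ) : BraidMonoid (n - 1) →* BraidGroup n :=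
  lift braidGen (fun _ _ => braidGen_braid) (fun _ _ => braidGen_comm)

@[simp]
theorem toBraidGroup_gen (i : Fin (n - 1)) : toBraidGroup n (gen i) = braidGen i :=
  lift_gen ..

theorem toBraidGroup_injective : Function.Injective (toBraidGroup n) := by
  obtain ⟨N, _, f, hf, hu⟩ := exists_injective_isUnit
    (garsideElt (n - 1) * garsideElt (n - 1)) garsideElt_sq_comm
  have hunit : ∀ i, IsUnit (f (gen i)) := fun i => by
    obtain ⟨a, ha⟩ := (gen_dvd_garsideElt i).mul_right (garsideElt (n - 1))
    obtain ⟨u, hu⟩ := hu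
    have h₁ : f (gen i) * f a = u := by rw [← map_mul, ← ha, hu]
    have h₂ : f a * f (gen i) = u := by
      rw [hu, ← map_mul]
      refine congrArg f (mul_left_cancel (a := gen i) ?_)
      rw [← mul_assoc, ← ha, garsideElt_sq_comm]
    exact isUnit_iff_exists_and_exists.2
      ⟨⟨f a * ↑u⁻¹, by rw [← mul_assoc, h₁, Units.mul_inv]⟩,
        ⟨↑u⁻¹ * f a, by rw [mul_assoc, h₂, Units.inv_mul]⟩⟩
  let g : BraidGroup n →* Nˣ := PresentedGroup.toGroup (f := fun i => (hunit i).unit) <| by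
    rintro _ ⟨i, j, ⟨hij, rfl⟩ | ⟨hij, rfl⟩⟩ <;>
      simp only [map_mul, map_inv, FreeGroup.lift_apply_of, mul_inv_eq_one] <;>
      ext <;> simp only [Units.val_mul, IsUnit.unit_spec, ← map_mul]
    · rw [gen_braid (.inl hij)]
    · rw [gen_comm (.inl hij)]
  have hg : ∀ a, (g (toBraidGroup n a) : N) = f a := fun a => by
    induction a using induction_on with
    | one => simp
    | gen_mul i a ih =>
      have hi : g (braidGen i) = (hunit i).unit := PresentedGroup.toGroup.of _
      rw [map_mul, map_mul, Units.val_mul, ih, toBraidGroup_gen, hi, IsUnit.unit_spec, map_mul]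
  intro a b h
  exact hf (by rw [← hg, ← hg, h])

theorem toBraidGroup_asc (k : ℕ) : toBraidGroup n (asc (n - 1) k) = braidAsc n k := by
  rw [asc, braidAsc, map_list_prod, List.map_map]
  congr 2
  ext k
  simp only [Function.comp_apply, gen', braidGen']
  split <;> simp

theorem toBraidGroup_delta (k : ℕ) : toBraidGroup n (delta (n - 1) k) =
    ((List.range k).map fun j => braidAsc n (k - j)).prod := by
  induction k with
  | zero => simp [delta]
  | succ k ih =>
    rw [delta, map_mul, ih, toBraidGroup_asc, List.range_succ_eq_map, List.map_cons,
      List.prod_cons, List.map_map]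
    simp [Function.comp_def]

theorem toBraidGroup_garsideElt : toBraidGroup n (garsideElt (n - 1)) = garside n :=
  toBraidGroup_delta _

theorem mem_of_braidGen_mem {H : Subgroup (BraidGroup n)} (h : ∀ i, braidGen i ∈ H)
    (x : BraidGroup n) : x ∈ H :=
  PresentedGroup.generated_by (braidRels n) H h x

theorem garside_sq_comm (x : BraidGroup n) :
    garside n * garside n * x = x * (garside n * garside n) := by
  have hx : x ∈ Subgroup.centralizer {garside n * garside n} := by
    refine mem_of_braidGen_mem (fun i => Subgroup.mem_centralizer_singleton_iff.2 ?_) x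
    have h := congrArg (toBraidGroup n) (garsideElt_sq_comm (gen i))
    simp only [map_mul, toBraidGroup_gen, toBraidGroup_garsideElt] at h
    exact h.symm
  exact (Subgroup.mem_centralizer_singleton_iff.1 hx).symm

theorem garside_sq_pow_comm (k : ℕ) (x : BraidGroup n) :
    (garside n * garside n) ^ k * x = x * (garside n * garside n) ^ k :=
  (Commute.pow_left (garside_sq_comm x) k).eq

theorem toBraidGroup_garsideElt_sq_pow (k : ℕ) :
    toBraidGroup n ((garsideElt (n - 1) * garsideElt (n - 1)) ^ k) =
      (garside n * garside n) ^ k := by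
  rw [map_pow, map_mul, toBraidGroup_garsideElt]

/-- Every braid becomes positive after multiplication by a power of the full twist. -/
theorem exists_eq_mul_pow (x : BraidGroup n) : ∃ (a : BraidMonoid (n - 1)) (k : ℕ),
    toBraidGroup n a = x * (garside n * garside n) ^ k := by
  let H : Subgroup (BraidGroup n) :=
    { carrier := {x | ∃ (a : BraidMonoid (n - 1)) (k : ℕ),
        toBraidGroup n a = x * (garside n * garside n) ^ k}
      one_mem' := ⟨1, 0, by simp⟩
      mul_mem' := by
        rintro x y ⟨a, k, ha⟩ ⟨b, l, hb⟩
        refine ⟨a * b, k + l, ?_⟩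
        rw [map_mul, ha, hb, mul_assoc, ← mul_assoc _ y, garside_sq_pow_comm, pow_add, mul_assoc,
          mul_assoc]
      inv_mem' := by
        rintro x ⟨a, k, ha⟩
        obtain ⟨b, l, hb⟩ := exists_mul_eq_garsideElt_sq_pow a
        refine ⟨b * (garsideElt (n - 1) * garsideElt (n - 1)) ^ k, l, mul_left_cancel (a := x) ?_⟩
        rw [map_mul, toBraidGroup_garsideElt_sq_pow, ← garside_sq_pow_comm, ← mul_assoc, ← ha,
          ← map_mul, hb, toBraidGroup_garsideElt_sq_pow, mul_inv_cancel_left] }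
  exact mem_of_braidGen_mem (H := H) (fun i => ⟨gen i, 0, by simp⟩) x

variable {rev : BraidGroup n → BraidGroup n}

theorem rev_toBraidGroup (hmul : ∀ x y, rev (x * y) = rev y * rev x)
    (hgen : ∀ i : Fin (n - 1), rev (braidGen i) = braidGen i) (a : BraidMonoid (n - 1)) :
    rev (toBraidGroup n a) = toBraidGroup n (BraidMonoid.rev a) := by
  induction a using induction_on with
  | one => simpa using hmul 1 1
  | gen_mul i a ih => rw [map_mul, hmul, ih, toBraidGroup_gen, hgen, rev_mul, map_mul, rev_gen,
      toBraidGroup_gen]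

theorem rev_garside (hmul : ∀ x y, rev (x * y) = rev y * rev x)
    (hgen : ∀ i : Fin (n - 1), rev (braidGen i) = braidGen i) : rev (garside n) = garside n := by
  rw [← toBraidGroup_garsideElt, rev_toBraidGroup hmul hgen, rev_garsideElt]

theorem rev_garside_sq_pow (hmul : ∀ x y, rev (x * y) = rev y * rev x)
    (hgen : ∀ i : Fin (n - 1), rev (braidGen i) = braidGen i) (k : ℕ) :
    rev ((garside n * garside n) ^ k) = (garside n * garside n) ^ k := by
  induction k with
  | zero => simpa using hmul 1 1
  | succ k ih => rw [pow_succ', hmul, hmul, ih, rev_garside hmul hgen, garside_sq_pow_comm]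

theorem mul_garside_sq_pow_mul_rev (hmul : ∀ x y, rev (x * y) = rev y * rev x)
    (hgen : ∀ i : Fin (n - 1), rev (braidGen i) = braidGen i) (x : BraidGroup n) (k : ℕ) :
    x * (garside n * garside n) ^ k * rev (x * (garside n * garside n) ^ k) =
      x * rev x * (garside n * garside n) ^ (2 * k) := by
  rw [hmul, rev_garside_sq_pow hmul hgen, two_mul, pow_add]
  simp only [mul_assoc]
  rw [garside_sq_pow_comm k (rev x), ← mul_assoc _ (rev x), garside_sq_pow_comm k (rev x),
    mul_assoc]

theorem exists_eq_mul_pow_add {x : BraidGroup n} {a : BraidMonoid (n - 1)} {k : ℕ}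
    (h : toBraidGroup n a = x * (garside n * garside n) ^ k) (l : ℕ) :
    ∃ b, toBraidGroup n b = x * (garside n * garside n) ^ (k + l) :=
  ⟨a * (garsideElt (n - 1) * garsideElt (n - 1)) ^ l, by
    rw [map_mul, toBraidGroup_garsideElt_sq_pow, h, pow_add, mul_assoc]⟩

end BraidGroup

section SquareRoot

open BraidMonoid

variable {m : ℕ} {rev : BraidGroup (m + 1) → BraidGroup (m + 1)}
  (φ : BraidMonoid m →* Equiv.Perm (Fin (m + 1)))

theorem braid_mul_rev_injective (hmul : ∀ x y, rev (x * y) = rev y * rev x)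
    (hgen : ∀ i : Fin (m + 1 - 1), rev (braidGen i) = braidGen i)
    (hφ : ∀ i, φ (gen i) = Equiv.swap i.castSucc i.succ) {x y : BraidGroup (m + 1)}
    (h : x * rev x = y * rev y) : x = y := by
  obtain ⟨a, k, ha⟩ := exists_eq_mul_pow x
  obtain ⟨b, l, hb⟩ := exists_eq_mul_pow y
  obtain ⟨a, ha⟩ := exists_eq_mul_pow_add ha l
  obtain ⟨b, hb⟩ := exists_eq_mul_pow_add hb k
  rw [add_comm l] at hb
  have hab : a = b := by
    refine mul_rev_injective φ hφ (toBraidGroup_injective (n := m + 1) ?_)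
    rw [map_mul, map_mul, ← rev_toBraidGroup hmul hgen, ← rev_toBraidGroup hmul hgen, ha, hb,
      mul_garside_sq_pow_mul_rev hmul hgen, mul_garside_sq_pow_mul_rev hmul hgen, h]
  exact mul_right_cancel (ha.symm.trans (hab ▸ hb))

theorem exists_braid_eq_mul_rev (hmul : ∀ x y, rev (x * y) = rev y * rev x)
    (hgen : ∀ i : Fin (m + 1 - 1), rev (braidGen i) = braidGen i)
    (π : BraidGroup (m + 1) →* Equiv.Perm (Fin (m + 1)))
    (hπ : ∀ i : Fin m, π (braidGen (n := m + 1) i) = Equiv.swap i.castSucc i.succ)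
    {x : BraidGroup (m + 1)} (hpure : π x = 1) (hpal : rev x = x) : ∃ d, x = d * rev d := by
  obtain ⟨a, k, ha⟩ := exists_eq_mul_pow x
  obtain ⟨q, hq⟩ := exists_eq_mul_pow_add ha k
  rw [← two_mul] at hq
  have hφ : ∀ i : Fin m, (π.comp (toBraidGroup (m + 1))) (gen i) =
      Equiv.swap i.castSucc i.succ := hπ
  have hΔ : π (garside (m + 1) * garside (m + 1)) = 1 := by
    have h := map_rev (π.comp (toBraidGroup (m + 1))) hφ (garsideElt m)
    rw [rev_garsideElt, eq_inv_iff_mul_eq_one, ← map_mul] at h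
    rw [← toBraidGroup_garsideElt, ← map_mul]
    exact h
  obtain ⟨d, hd⟩ := exists_eq_mul_rev (q := q) (π.comp (toBraidGroup (m + 1))) hφ
    (toBraidGroup_injective (n := m + 1) (by
      rw [← rev_toBraidGroup hmul hgen, hq, hmul, rev_garside_sq_pow hmul hgen, hpal,
        garside_sq_pow_comm]))
    (by rw [MonoidHom.comp_apply, hq, map_mul, map_pow, hΔ, hpure, one_pow, one_mul])
  refine ⟨toBraidGroup (m + 1) d * ((garside (m + 1) * garside (m + 1)) ^ k)⁻¹,
    mul_right_cancel (b := (garside (m + 1) * garside (m + 1)) ^ (2 * k)) ?_⟩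
  rw [← mul_garside_sq_pow_mul_rev hmul hgen, inv_mul_cancel_right, rev_toBraidGroup hmul hgen,
    ← map_mul, ← hq]
  exact congrArg _ hd

end SquareRoot

/-- Let `n ≥ 2` and let `x ∈ B n` be pure (`π x = 1`), palindromic
(`rev x = x`) and `τ`-invariant (`Δₙ⁻¹ x Δₙ = x`).  Then there is a unique `δ ∈ B n` with
`x = δ * rev δ` and `Δₙ⁻¹ δ Δₙ = δ`. -/
theorem existsUnique_tau_invariant_square_root
    (n : ℕ) (hn : 2 ≤ n)
    (rev : BraidGroup n → BraidGroup n)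
    (hmul : ∀ x y, rev (x * y) = rev y * rev x)
    (hinv : ∀ x, rev (rev x) = x)
    (hgen : ∀ i : Fin (n - 1), rev (braidGen i) = braidGen i)
    (π : BraidGroup n →* Equiv.Perm (Fin n))
    (hπ : ∀ i : Fin (n - 1),
      π (braidGen i) =
        Equiv.swap (⟨(i : ℕ), by have := i.isLt; omega⟩ : Fin n)
          (⟨(i : ℕ) + 1, by have := i.isLt; omega⟩ : Fin n))
    (x : BraidGroup n)
    (hpure : π x = 1)
    (hpal : rev x = x)
    (hτ : (garside n)⁻¹ * x * garside n = x) :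
    ∃! δ : BraidGroup n, x = δ * rev δ ∧ (garside n)⁻¹ * δ * garside n = δ := by
  obtain ⟨m, rfl⟩ : ∃ m, n = m + 1 := ⟨n - 1, by omega⟩
  have hφ : ∀ i : Fin m, (π.comp (toBraidGroup (m + 1))) (BraidMonoid.gen i) =
      Equiv.swap i.castSucc i.succ := hπ
  obtain ⟨δ, rfl⟩ := exists_braid_eq_mul_rev hmul hgen π hπ hpure hpal
  refine ⟨δ, ⟨rfl, ?_⟩, fun δ' h => (braid_mul_rev_injective _ hmul hgen hφ h.1).symm⟩
  refine braid_mul_rev_injective _ hmul hgen hφ ?_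
  have hrev : rev (garside (m + 1))⁻¹ = (garside (m + 1))⁻¹ := by
    have hone : rev 1 = 1 := by simpa using hmul 1 1
    refine eq_inv_of_mul_eq_one_right ?_
    rw [← rev_garside hmul hgen, ← hmul, rev_garside hmul hgen, inv_mul_cancel, hone]
  have hcomm := garside_sq_comm (rev δ)
  rw [hmul, hmul, hrev, rev_garside hmul hgen, ← hτ]
  calc (garside (m + 1))⁻¹ * δ * garside (m + 1) *
        (garside (m + 1) * (rev δ * (garside (m + 1))⁻¹))
      = (garside (m + 1))⁻¹ * δ * (garside (m + 1) * garside (m + 1) * rev δ) *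
          (garside (m + 1))⁻¹ := by group
    _ = (garside (m + 1))⁻¹ * (δ * rev δ) * garside (m + 1) := by rw [hcomm]; group
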